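/- arXiv:2302.12351 — 3 statements merged into one kernel-verified Lean document; each statement's English description precedes it below -/
import Mathlib

section
/- When p = 2, the empirical Rademacher complexity of the product class equals the expected spectral norm of the signed empirical covariance: R(f∘HΔH) = (W²/n) · E_σ[ ‖ Σ_{i=1}^n σ_i x_i x_iᵀ ‖_2 ]. -/
open scoped BigOperators

noncomputable def supNorm {d : ℕ} (v : Fin d → ℝ) : ℝ := ⨆ i, |v i|

noncomputable def pNorm {d : ℕ} (p : ℝ) (v : Fin d → ℝ) : ℝ := (∑ i, |v i| ^ p) ^ (1 / p)

noncomputable def twoNorm {d : ℕ} (v : Fin d → ℝ) : ℝ := Real.sqrt (∑ i, (v i) ^ 2)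

def ip {d : ℕ} (w x : Fin d → ℝ) : ℝ := ∑ i, w i * x i

noncomputable def outer {d : ℕ} (v : Fin d → ℝ) : Matrix (Fin d) (Fin d) ℝ :=
  Matrix.of fun a b => v a * v b

noncomputable def specNorm {d : ℕ} (A : Matrix (Fin d) (Fin d) ℝ) : ℝ :=
  sSup {y : ℝ | ∃ v : Fin d → ℝ, twoNorm v ≤ 1 ∧ y = twoNorm (A.mulVec v)}

noncomputable def Esign (n : ℕ) (f : (Fin n → ℝ) → ℝ) : ℝ :=
  (∑ s : Fin n → Bool, f fun i => if s i then (1 : ℝ) else -1) / 2 ^ n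

theorem twoNorm_eq_aux {d : ℕ} (v : Fin d → ℝ) : twoNorm v = ‖WithLp.toLp 2 v‖ := by
  simp [twoNorm, EuclideanSpace.norm_eq]

theorem twoNorm_sq_aux {d : ℕ} (v : Fin d → ℝ) : ip v v = twoNorm v ^ 2 := by
  rw [twoNorm, Real.sq_sqrt (Finset.sum_nonneg fun i _ => sq_nonneg _)]
  simp [ip, pow_two]

theorem twoNorm_nonneg_aux {d : ℕ} (v : Fin d → ℝ) : 0 ≤ twoNorm v := Real.sqrt_nonneg _

theorem twoNorm_smul_aux {d : ℕ} (c : ℝ) (v : Fin d → ℝ) :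
    twoNorm (c • v) = |c| * twoNorm v := by
  rw [twoNorm_eq_aux, twoNorm_eq_aux, WithLp.toLp_smul, norm_smul, Real.norm_eq_abs]

theorem ip_le_aux {d : ℕ} (v w : Fin d → ℝ) : ip v w ≤ twoNorm v * twoNorm w :=
  Real.sum_mul_le_sqrt_mul_sqrt _ _ _

theorem ip_smul_left_aux {d : ℕ} (c : ℝ) (v w : Fin d → ℝ) : ip (c • v) w = c * ip v w := by
  simp [ip, Finset.mul_sum, mul_assoc]

theorem ip_smul_right_aux {d : ℕ} (c : ℝ) (v w : Fin d → ℝ) : ip v (c • w) = c * ip v w := by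
  simp [ip, Finset.mul_sum, mul_left_comm]

theorem bdd_aux {d : ℕ} (A : Matrix (Fin d) (Fin d) ℝ) :
    BddAbove {y : ℝ | ∃ v : Fin d → ℝ, twoNorm v ≤ 1 ∧ y = twoNorm (A.mulVec v)} := by
  refine ⟨‖Matrix.toEuclideanCLM (𝕜 := ℝ) A‖, ?_⟩
  rintro y ⟨v, hv, rfl⟩
  rw [twoNorm_eq_aux] at *
  have h := (Matrix.toEuclideanCLM (𝕜 := ℝ) A).le_opNorm (WithLp.toLp 2 v)
  rw [Matrix.toEuclideanCLM_toLp] at h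
  exact h.trans (mul_le_of_le_one_right (norm_nonneg _) hv)

theorem quad_aux {d n : ℕ} (x : Fin n → Fin d → ℝ) (σ : Fin n → ℝ) (w w' : Fin d → ℝ) :
    ∑ i, σ i * (ip w (x i) * ip w' (x i)) =
      ip w ((∑ i, σ i • outer (x i)).mulVec w') := by
  have h : ∀ i, (σ i • outer (x i)).mulVec w' = (σ i * ip w' (x i)) • x i := by
    intro i
    ext a
    simp only [Matrix.mulVec, dotProduct, outer, ip, Matrix.smul_apply, Matrix.of_apply,
      Pi.smul_apply, smul_eq_mul, Finset.mul_sum, Finset.sum_mul]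
    exact Finset.sum_congr rfl fun b _ => by ring
  rw [Matrix.sum_mulVec]
  simp only [h]
  have h2 : ∀ f : Fin n → Fin d → ℝ, ip w (∑ i, f i) = ∑ i, ip w (f i) := by
    intro f
    simp only [ip, Finset.sum_apply, Finset.mul_sum]
    exact Finset.sum_comm
  rw [h2]
  refine Finset.sum_congr rfl fun i _ => ?_
  rw [ip_smul_right_aux]
  ring

theorem sup_aux {d n : ℕ} (hn : 1 ≤ n) (W : ℝ) (hW : 0 < W)
    (A : Matrix (Fin d) (Fin d) ℝ) :
    sSup {r : ℝ | ∃ w w' : Fin d → ℝ, twoNorm w ≤ W ∧ twoNorm w' ≤ W ∧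
        r = (1 / (n : ℝ)) * ip w (A.mulVec w')} = W ^ 2 / (n : ℝ) * specNorm A := by
  have hn' : (0 : ℝ) < n := by exact_mod_cast hn
  have z : twoNorm (0 : Fin d → ℝ) = 0 := by simp [twoNorm]
  refine IsLUB.csSup_eq ⟨?_, ?_⟩ ⟨_, 0, 0, by rw [z]; exact hW.le, by rw [z]; exact hW.le, rfl⟩
  · rintro r ⟨w, w', hw, hw', rfl⟩
    have h1 : twoNorm (A.mulVec (W⁻¹ • w')) ≤ specNorm A := by
      refine le_csSup (bdd_aux A) ⟨_, ?_, rfl⟩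
      rw [twoNorm_smul_aux, abs_of_pos (inv_pos.2 hW), inv_mul_le_iff₀ hW, mul_one]
      exact hw'
    rw [Matrix.mulVec_smul, twoNorm_smul_aux, abs_of_pos (inv_pos.2 hW),
      inv_mul_le_iff₀ hW] at h1
    have h2 := (ip_le_aux w (A.mulVec w')).trans
      (mul_le_mul hw h1 (twoNorm_nonneg_aux _) hW.le)
    calc _ ≤ 1 / (n : ℝ) * (W * (W * specNorm A)) := by gcongr
      _ = _ := by ring
  · intro b hb
    have key : specNorm A ≤ n * b / W ^ 2 := by
      refine csSup_le ⟨_, 0, by rw [z]; exact zero_le_one, rfl⟩ ?_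
      rintro y ⟨v, hv, rfl⟩
      set t := twoNorm (A.mulVec v) with ht
      have ht0 : 0 ≤ t := twoNorm_nonneg_aux _
      have := hb ⟨(W * t⁻¹) • A.mulVec v, W • v, ?_, ?_, rfl⟩
      · rw [Matrix.mulVec_smul, ip_smul_left_aux, ip_smul_right_aux, twoNorm_sq_aux, ← ht] at this
        have e : W * t⁻¹ * (W * t ^ 2) = W ^ 2 * t := by
          rcases eq_or_ne t 0 with h | h
          · simp [h]
          · field_simp
        rw [e, one_div, inv_mul_le_iff₀ hn'] at this
        rw [le_div_iff₀ (by positivity)]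
        linarith
      · rw [twoNorm_smul_aux, abs_of_nonneg (by positivity), ← ht, mul_assoc]
        exact mul_le_of_le_one_right hW.le inv_mul_le_one
      · rw [twoNorm_smul_aux, abs_of_pos hW]
        exact mul_le_of_le_one_right hW.le hv
    rw [le_div_iff₀ (by positivity)] at key
    rw [div_mul_eq_mul_div, div_le_iff₀ hn']
    linarith

theorem stmt2 {d n : ℕ} (hd : 1 ≤ d) (hn : 1 ≤ n) (W : ℝ) (hW : 0 < W)
    (x : Fin n → Fin d → ℝ) :
    Esign n (fun σ => sSup {r : ℝ | ∃ w w' : Fin d → ℝ,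
        twoNorm w ≤ W ∧ twoNorm w' ≤ W ∧
        r = (1 / (n : ℝ)) * ∑ i, σ i * (ip w (x i) * ip w' (x i))}) =
      W ^ 2 / (n : ℝ) * Esign n (fun σ => specNorm (∑ i, σ i • outer (x i))) := by
  simp only [Esign, quad_aux, sup_aux hn W hW]
  rw [← Finset.mul_sum, mul_div_assoc]
end

section
/- The adversarial Rademacher complexity over HΔH of two-layer ReLU networks satisfies R(f̃∘HΔH) ≤ (2 A² W² / n) · [ √( Σ_{i=1}^n ( ‖x_i‖_q² + d^{2/q} ε² )² ) · √( 4 m (1 + d) log(3n) ) + 4 ( max_{i ∈ [n]} ‖x_i‖_q² + d^{2/q} ε² ) ]. -/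
open scoped BigOperators

noncomputable def reluNet {d m : ℕ} (a : Fin m → ℝ) (U : Fin m → Fin d → ℝ)
    (x : Fin d → ℝ) : ℝ :=
  ∑ r, a r * max 0 (ip (U r) x)


open MeasureTheory Metric Module in
theorem sep_card {E : Type*} [NormedAddCommGroup E] [NormedSpace ℝ E] [FiniteDimensional ℝ E]
    (n : ℕ) (hn : 1 ≤ n) (R : ℝ) (hR : 0 < R)
    (s : Finset E) (hs : ∀ c ∈ s, ‖c‖ ≤ R)
    (h : ∀ c ∈ s, ∀ d ∈ s, c ≠ d → R / n ≤ ‖c - d‖) :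
    (s.card : ℝ) ≤ (3 * n : ℝ) ^ finrank ℝ E := by
  borelize E
  have hn' : (1 : ℝ) ≤ n := by exact_mod_cast hn
  let μ : Measure E := Measure.addHaar
  obtain ⟨δ, hδ⟩ : ∃ δ : ℝ, δ = R / n / 2 := ⟨_, rfl⟩
  have δpos : 0 < δ := by rw [hδ]; positivity
  obtain ⟨ρ, hρ⟩ : ∃ ρ : ℝ, ρ = (3 * n) * δ := ⟨_, rfl⟩
  have ρpos : 0 < ρ := by rw [hρ]; positivity
  have hle : δ + R ≤ ρ := by
    have : R = 2 * n * δ := by rw [hδ]; field_simp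
    rw [hρ]; nlinarith
  set A := ⋃ c ∈ s, ball (c : E) δ with hA
  have D : Set.Pairwise (s : Set E) (Function.onFun Disjoint fun c => ball (c : E) δ) := by
    rintro c hc d hd hcd
    apply ball_disjoint_ball
    rw [dist_eq_norm]
    have := h c hc d hd hcd
    rw [hδ]; linarith
  have A_subset : A ⊆ ball (0 : E) ρ := by
    refine Set.iUnion₂_subset fun x hx => ?_
    apply ball_subset_ball'
    rw [dist_zero_right]
    linarith [hs x hx]
  have I :
    (s.card : ENNReal) * ENNReal.ofReal (δ ^ finrank ℝ E) * μ (ball 0 1) ≤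
      ENNReal.ofReal (ρ ^ finrank ℝ E) * μ (ball 0 1) :=
    calc
      (s.card : ENNReal) * ENNReal.ofReal (δ ^ finrank ℝ E) * μ (ball 0 1) = μ A := by
        rw [hA, measure_biUnion_finset D fun c _ => measurableSet_ball]
        simp only [μ.addHaar_ball_of_pos _ δpos]
        simp only [Finset.sum_const, nsmul_eq_mul, mul_assoc]
      _ ≤ μ (ball (0 : E) ρ) := measure_mono A_subset
      _ = ENNReal.ofReal (ρ ^ finrank ℝ E) * μ (ball 0 1) := by
        simp only [μ.addHaar_ball_of_pos _ ρpos]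
  have J : (s.card : ENNReal) * ENNReal.ofReal (δ ^ finrank ℝ E) ≤ ENNReal.ofReal (ρ ^ finrank ℝ E) :=
    (ENNReal.mul_le_mul_iff_left (measure_ball_pos _ _ zero_lt_one).ne' measure_ball_lt_top.ne).1 I
  have := ENNReal.toReal_le_of_le_ofReal (pow_nonneg ρpos.le _) J
  rw [ENNReal.toReal_mul, ENNReal.toReal_ofReal (by positivity), hρ, mul_pow] at this
  exact le_of_mul_le_mul_right (by simpa using this) (pow_pos δpos (finrank ℝ E))

open Module in
theorem cover_gen {E : Type*} [NormedAddCommGroup E] [NormedSpace ℝ E] [FiniteDimensional ℝ E]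
    (n : ℕ) (hn : 1 ≤ n) (R : ℝ) (hR : 0 < R) :
    ∃ s : Finset E, (∀ c ∈ s, ‖c‖ ≤ R) ∧ (s.card : ℝ) ≤ (3 * n : ℝ) ^ finrank ℝ E ∧
      ∀ v : E, ‖v‖ ≤ R → ∃ c ∈ s, ‖v - c‖ ≤ R / n := by
  classical
  by_contra hcon
  have key : ∀ k : ℕ, ∃ s : Finset E, (∀ c ∈ s, ‖c‖ ≤ R) ∧
      (∀ c ∈ s, ∀ d ∈ s, c ≠ d → R / n ≤ ‖c - d‖) ∧ s.card = k := by
    intro k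
    induction k with
    | zero => exact ⟨∅, by simp, by simp, by simp⟩
    | succ k ih =>
      obtain ⟨s, h1, h2, h3⟩ := ih
      have : ∃ v : E, ‖v‖ ≤ R ∧ ∀ c ∈ s, R / n < ‖v - c‖ := by
        by_contra hv
        push Not at hv
        exact hcon ⟨s, h1, sep_card n hn R hR s h1 h2, hv⟩
      obtain ⟨v, hv, hv2⟩ := this
      have hpos : (0 : ℝ) < R / n := by positivity
      have hvs : v ∉ s := fun hvs => by
        have := hv2 v hvs
        simp at this; linarith
      refine ⟨insert v s, ?_, ?_, ?_⟩
      · simpa using ⟨hv, h1⟩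
      · intro c hc d hd hcd
        rcases Finset.mem_insert.1 hc with hcv | hc <;> rcases Finset.mem_insert.1 hd with hdv | hd
        · exact absurd (hcv.trans hdv.symm) hcd
        · rw [hcv]; exact (hv2 d hd).le
        · rw [hdv, norm_sub_rev]; exact (hv2 c hc).le
        · exact h2 c hc d hd hcd
      · rw [Finset.card_insert_of_notMem hvs, h3]
  obtain ⟨k, hk⟩ := exists_nat_gt ((3 * n : ℝ) ^ finrank ℝ E)
  obtain ⟨s, h1, h2, h3⟩ := key k
  have := sep_card n hn R hR s h1 h2
  rw [h3] at this
  linarith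

theorem cover_p (k : ℕ) (p : ℝ) (hp : 1 ≤ p) (n : ℕ) (hn : 1 ≤ n) (R : ℝ) (hR : 0 < R) :
    ∃ s : Finset (Fin k → ℝ), (∀ c ∈ s, pNorm p c ≤ R) ∧ (s.card : ℝ) ≤ (3 * n : ℝ) ^ k ∧
      ∀ v, pNorm p v ≤ R → ∃ c ∈ s, pNorm p (v - c) ≤ R / n := by
  classical
  have hF : Fact (1 ≤ ENNReal.ofReal p) := ⟨by simpa using hp⟩
  have hto : (ENNReal.ofReal p).toReal = p := ENNReal.toReal_ofReal (by linarith)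
  have hnorm : ∀ f : PiLp (ENNReal.ofReal p) (fun _ : Fin k => ℝ), ‖f‖ = pNorm p (WithLp.ofLp f) := by
    intro f
    rw [PiLp.norm_eq_sum (by rw [hto]; linarith), hto]
    simp [pNorm]
  obtain ⟨s, h1, h2, h3⟩ := cover_gen (E := PiLp (ENNReal.ofReal p) (fun _ : Fin k => ℝ)) n hn R hR
  have hfr : Module.finrank ℝ (PiLp (ENNReal.ofReal p) (fun _ : Fin k => ℝ)) = k := by
    rw [LinearEquiv.finrank_eq (WithLp.linearEquiv (ENNReal.ofReal p) ℝ (Fin k → ℝ))]; simp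
  rw [hfr] at h2
  refine ⟨s.image WithLp.ofLp, ?_, ?_, ?_⟩
  · intro c hc
    obtain ⟨c', hc', rfl⟩ := Finset.mem_image.1 hc
    rw [← hnorm]; exact h1 _ hc'
  · refine le_trans ?_ h2
    exact_mod_cast Finset.card_image_le
  · intro v hv
    obtain ⟨c, hc, hvc⟩ := h3 (WithLp.toLp _ v) (by rw [hnorm]; exact hv)
    refine ⟨_, Finset.mem_image_of_mem _ hc, ?_⟩
    rw [hnorm] at hvc
    simpa using hvc

theorem massart {T : Type*} [Fintype T] (n : ℕ) (M : (Fin n → Bool) → ℝ)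
    (t : T → Fin n → ℝ) (b : Fin n → ℝ) (L : ℝ) (hL : 0 < L)
    (hcard : (Fintype.card T : ℝ) ≤ Real.exp L)
    (hb : ∀ θ i, |t θ i| ≤ b i)
    (hM : ∀ s, ∃ θ, M s ≤ ∑ i, (if s i then (1 : ℝ) else -1) * t θ i) :
    (∑ s, M s) / 2 ^ n ≤ Real.sqrt (∑ i, b i ^ 2) * Real.sqrt (2 * L) := by
  set S := ∑ i, b i ^ 2 with hS
  have hS0 : 0 ≤ S := Finset.sum_nonneg fun i _ => sq_nonneg _
  set E := (∑ s, M s) / 2 ^ n with hE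
  have key : ∀ l : ℝ, 0 < l → l * E ≤ L + l ^ 2 * S / 2 := by
    intro l hl
    have h1 : Real.exp (l * E) ≤ ∑ s : Fin n → Bool, (1 / 2 ^ n : ℝ) * Real.exp (l * M s) := by
      have := convexOn_exp.map_sum_le (t := (Finset.univ : Finset (Fin n → Bool)))
        (w := fun _ => (1 / 2 ^ n : ℝ)) (p := fun s => l * M s)
        (fun _ _ => by positivity) (by simp) (fun _ _ => Set.mem_univ _)
      simp only [smul_eq_mul] at this
      refine le_trans (le_of_eq ?_) this
      congr 1
      rw [hE, Finset.sum_div, Finset.mul_sum]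
      refine Finset.sum_congr rfl fun s _ => ?_
      ring
    have h2 : ∀ s : Fin n → Bool, Real.exp (l * M s) ≤
        ∑ θ : T, ∏ i, Real.exp (l * ((if s i then (1 : ℝ) else -1) * t θ i)) := by
      intro s
      obtain ⟨θ, hθ⟩ := hM s
      calc Real.exp (l * M s) ≤ ∏ i, Real.exp (l * ((if s i then (1 : ℝ) else -1) * t θ i)) := by
            rw [← Real.exp_sum, ← Finset.mul_sum]
            exact Real.exp_le_exp.2 (mul_le_mul_of_nonneg_left hθ hl.le)
        _ ≤ _ := Finset.single_le_sum (f := fun θ => ∏ i, Real.exp (l * ((if s i then (1 : ℝ) else -1) * t θ i)))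
            (fun θ _ => Finset.prod_nonneg fun i _ => (Real.exp_pos _).le) (Finset.mem_univ θ)
    have h3 : ∀ θ : T, ∑ s : Fin n → Bool, (1 / 2 ^ n : ℝ) *
        ∏ i, Real.exp (l * ((if s i then (1 : ℝ) else -1) * t θ i)) ≤ Real.exp (l ^ 2 * S / 2) := by
      intro θ
      have e1 : ∑ s : Fin n → Bool, 
          ∏ i, Real.exp (l * ((if s i then (1 : ℝ) else -1) * t θ i))
          = ∏ i, (2 * Real.cosh (l * t θ i)) := by
        have := Finset.prod_univ_sum (fun _ : Fin n => (Finset.univ : Finset Bool))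
          (fun i c => Real.exp (l * ((if c then (1 : ℝ) else -1) * t θ i)))
        rw [Fintype.piFinset_univ] at this
        rw [← this]
        refine Finset.prod_congr rfl fun i _ => ?_
        rw [Fintype.sum_bool, Real.cosh_eq]
        simp
        ring
      rw [← Finset.mul_sum, e1, Finset.prod_mul_distrib]
      simp only [Finset.prod_const, Finset.card_univ, Fintype.card_fin]
      rw [← mul_assoc, one_div, inv_mul_cancel₀ (by positivity), one_mul]
      calc ∏ i, Real.cosh (l * t θ i) ≤ ∏ i, Real.exp (l ^ 2 * b i ^ 2 / 2) := by
            refine Finset.prod_le_prod (fun i _ => (Real.cosh_pos _).le) fun i _ => ?_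
            refine (Real.cosh_le_exp_half_sq _).trans (Real.exp_le_exp.2 ?_)
            rw [mul_pow]
            have : t θ i ^ 2 ≤ b i ^ 2 := sq_le_sq.2 ((hb θ i).trans (le_abs_self _))
            have := mul_le_mul_of_nonneg_left this (sq_nonneg l)
            linarith
        _ = _ := by
            rw [← Real.exp_sum, hS, Finset.mul_sum, Finset.sum_div]
    have h4 : Real.exp (l * E) ≤ Real.exp (L + l ^ 2 * S / 2) := by
      calc Real.exp (l * E) ≤ _ := h1
        _ ≤ ∑ s : Fin n → Bool, (1 / 2 ^ n : ℝ) * 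
            ∑ θ : T, ∏ i, Real.exp (l * ((if s i then (1 : ℝ) else -1) * t θ i)) :=
            Finset.sum_le_sum fun s _ => mul_le_mul_of_nonneg_left (h2 s) (by positivity)
        _ = ∑ θ : T, ∑ s : Fin n → Bool, (1 / 2 ^ n : ℝ) * 
            ∏ i, Real.exp (l * ((if s i then (1 : ℝ) else -1) * t θ i)) := by
            simp_rw [Finset.mul_sum]
            rw [Finset.sum_comm]
        _ ≤ ∑ θ : T, Real.exp (l ^ 2 * S / 2) := Finset.sum_le_sum fun θ _ => h3 θ
        _ = Fintype.card T * Real.exp (l ^ 2 * S / 2) := by simp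
        _ ≤ Real.exp L * Real.exp (l ^ 2 * S / 2) :=
            mul_le_mul_of_nonneg_right hcard (Real.exp_pos _).le
        _ = _ := (Real.exp_add _ _).symm
    exact Real.exp_le_exp.1 h4
  rcases hS0.eq_or_lt with h0 | h0
  · rw [← h0]
    simp only [Real.sqrt_zero, zero_mul]
    by_contra hc
    push Not at hc
    have := key (2 * L / E) (by positivity)
    rw [← h0, div_mul_cancel₀ _ hc.ne'] at this
    linarith
  · obtain ⟨r, hr⟩ : ∃ r, r = Real.sqrt S := ⟨_, rfl⟩
    obtain ⟨c, hc⟩ : ∃ c, c = Real.sqrt (2 * L) := ⟨_, rfl⟩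
    have r0 : 0 < r := hr ▸ Real.sqrt_pos.2 h0
    have c0 : 0 < c := hc ▸ Real.sqrt_pos.2 (by linarith)
    have r2 : r ^ 2 = S := hr ▸ Real.sq_sqrt hS0
    have c2 : c ^ 2 = 2 * L := hc ▸ Real.sq_sqrt (by linarith)
    rw [← hr, ← hc]
    have := key (c / r) (by positivity)
    have e : L + (c / r) ^ 2 * S / 2 = c ^ 2 := by
      rw [← r2]; field_simp; linarith
    rw [e, div_mul_eq_mul_div, div_le_iff₀ r0] at this
    nlinarith

noncomputable def Qn {d : ℕ} (p : ℝ) (v : Fin d → ℝ) : ℝ :=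
  if p = 1 then supNorm v else pNorm (p / (p - 1)) v

theorem abs_le_supNorm {d : ℕ} (v : Fin d → ℝ) (i : Fin d) : |v i| ≤ supNorm v :=
  le_ciSup (f := fun i => |v i|) (Set.finite_range _).bddAbove i

theorem Qn_nonneg {d : ℕ} (p : ℝ) (v : Fin d → ℝ) : 0 ≤ Qn p v := by
  unfold Qn
  split_ifs
  · exact Real.iSup_nonneg fun i => abs_nonneg _
  · exact Real.rpow_nonneg (Finset.sum_nonneg fun i _ => Real.rpow_nonneg (abs_nonneg _) _) _

theorem pNorm_nonneg {d : ℕ} (p : ℝ) (v : Fin d → ℝ) : 0 ≤ pNorm p v :=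
  Real.rpow_nonneg (Finset.sum_nonneg fun i _ => Real.rpow_nonneg (abs_nonneg _) _) _

theorem holderC {p : ℝ} (hp : 1 ≤ p) (h1 : p ≠ 1) : p.HolderConjugate (p / (p - 1)) :=
  Real.HolderConjugate.conjExponent (lt_of_le_of_ne hp (Ne.symm h1))

theorem ip_le {d : ℕ} (p : ℝ) (hp : 1 ≤ p) (u v : Fin d → ℝ) : |ip u v| ≤ pNorm p u * Qn p v := by
  have h0 : |ip u v| ≤ ∑ i, |u i| * |v i| := by
    refine (Finset.abs_sum_le_sum_abs _ _).trans (le_of_eq ?_)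
    simp [abs_mul]
  refine h0.trans ?_
  unfold Qn
  split_ifs with h
  · subst h
    simp only [pNorm, Real.rpow_one, div_one]
    rw [Finset.sum_mul]
    exact Finset.sum_le_sum fun i _ => mul_le_mul_of_nonneg_left (abs_le_supNorm v i) (abs_nonneg _)
  · have := Real.inner_le_Lp_mul_Lq Finset.univ (fun i => |u i|) (fun i => |v i|) (holderC hp h)
    simpa [pNorm] using this

theorem Qn_add {d : ℕ} (hd : 1 ≤ d) (p : ℝ) (hp : 1 ≤ p) (u v : Fin d → ℝ) :
    Qn p (u + v) ≤ Qn p u + Qn p v := by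
  unfold Qn
  split_ifs with h
  · haveI : Nonempty (Fin d) := ⟨⟨0, hd⟩⟩
    exact ciSup_le fun i => (abs_add_le _ _).trans (add_le_add (abs_le_supNorm u i) (abs_le_supNorm v i))
  · exact Real.Lp_add_le Finset.univ u v (holderC hp h).symm.lt.le

theorem Qn_le {d : ℕ} (p : ℝ) (hp : 1 ≤ p) (v : Fin d → ℝ) (ε : ℝ) (hε : 0 ≤ ε)
    (hv : supNorm v ≤ ε) : Qn p v ≤ (d : ℝ) ^ (1 - 1 / p) * ε := by
  unfold Qn
  split_ifs with h
  · subst h; simpa using hv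
  · have hc := holderC hp h
    have hq : (1 : ℝ) / (p / (p - 1)) = 1 - 1 / p := by
      have : p ≠ 0 := by linarith
      field_simp
    have q0 : 0 < p / (p - 1) := hc.symm.pos
    calc pNorm (p / (p - 1)) v ≤ (∑ i : Fin d, ε ^ (p / (p - 1))) ^ (1 / (p / (p - 1))) := by
          refine Real.rpow_le_rpow (Finset.sum_nonneg fun i _ => Real.rpow_nonneg (abs_nonneg _) _) ?_ (by positivity)
          exact Finset.sum_le_sum fun i _ =>
            Real.rpow_le_rpow (abs_nonneg _) ((abs_le_supNorm v i).trans hv) q0.le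
      _ = _ := by
          rw [Finset.sum_const, Finset.card_univ, Fintype.card_fin, nsmul_eq_mul,
            Real.mul_rpow (by positivity) (by positivity), ← Real.rpow_mul hε, mul_one_div_cancel q0.ne',
            Real.rpow_one, hq]

theorem Qn_sq {d : ℕ} (hd : 1 ≤ d) (p : ℝ) (hp : 1 ≤ p) (x v : Fin d → ℝ) (ε : ℝ) (hε : 0 ≤ ε)
    (hv : supNorm v ≤ ε) :
    Qn p (x + v) ^ 2 ≤ 2 * (Qn p x ^ 2 + (d : ℝ) ^ (2 * (1 - 1 / p)) * ε ^ 2) := by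
  have h1 := (Qn_add hd p hp x v).trans (add_le_add_right (Qn_le p hp v ε hε hv) _)
  have h2 : (d : ℝ) ^ (2 * (1 - 1 / p)) = ((d : ℝ) ^ (1 - 1 / p)) ^ 2 := by
    rw [mul_comm, Real.rpow_mul (by positivity)]; norm_cast
  rw [h2, ← mul_pow]
  have h3 := pow_le_pow_left₀ (Qn_nonneg p _) h1 2
  nlinarith [sq_nonneg (Qn p x - (d : ℝ) ^ (1 - 1 / p) * ε)]

theorem relu_abs {d m : ℕ} (p A W : ℝ) (hp : 1 ≤ p) (hW : 0 ≤ W) (a : Fin m → ℝ)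
    (U : Fin m → Fin d → ℝ) (z : Fin d → ℝ) (ha : ∑ j, |a j| ≤ A) (hU : ∀ j, pNorm p (U j) ≤ W) :
    |reluNet a U z| ≤ A * W * Qn p z := by
  have hQ := Qn_nonneg p z
  calc |reluNet a U z| ≤ ∑ j, |a j| * (W * Qn p z) := by
        refine (Finset.abs_sum_le_sum_abs _ _).trans (Finset.sum_le_sum fun j _ => ?_)
        rw [abs_mul]
        refine mul_le_mul_of_nonneg_left ?_ (abs_nonneg _)
        rw [abs_of_nonneg (le_max_left _ _)]
        refine max_le (by positivity) ((le_abs_self _).trans ((ip_le p hp _ _).trans ?_))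
        exact mul_le_mul_of_nonneg_right (hU j) hQ
    _ ≤ A * W * Qn p z := by
        rw [← Finset.sum_mul, mul_assoc]
        exact mul_le_mul_of_nonneg_right ha (by positivity)

theorem relu_diff {d m : ℕ} (p A W ρ : ℝ) (hp : 1 ≤ p) (hW : 0 ≤ W) (hρ : 0 ≤ ρ) (a b : Fin m → ℝ)
    (U V : Fin m → Fin d → ℝ) (z : Fin d → ℝ) (ha : ∑ j, |a j - b j| ≤ A * ρ)
    (hb : ∑ j, |b j| ≤ A) 
    (hU : ∀ j, pNorm p (U j) ≤ W) (hUV : ∀ j, pNorm p (U j - V j) ≤ W * ρ) :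
    |reluNet a U z - reluNet b V z| ≤ 2 * ρ * (A * W * Qn p z) := by
  have hQ := Qn_nonneg p z
  have e : reluNet a U z - reluNet b V z = reluNet (fun j => a j - b j) U z +
      ∑ j, b j * (max 0 (ip (U j) z) - max 0 (ip (V j) z)) := by
    simp only [reluNet]
    rw [← Finset.sum_sub_distrib, ← Finset.sum_add_distrib]
    exact Finset.sum_congr rfl fun j _ => by ring
  have h1 := relu_abs p (A * ρ) W hp hW (fun j => a j - b j) U z ha hU
  have h2 : |∑ j, b j * (max 0 (ip (U j) z) - max 0 (ip (V j) z))| ≤ A * (W * ρ * Qn p z) := by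
    calc _ ≤ ∑ j, |b j| * (W * ρ * Qn p z) := by
          refine (Finset.abs_sum_le_sum_abs _ _).trans (Finset.sum_le_sum fun j _ => ?_)
          rw [abs_mul]
          refine mul_le_mul_of_nonneg_left ?_ (abs_nonneg _)
          refine (abs_max_sub_max_le_max 0 _ 0 _).trans ?_
          refine max_le (by simp; positivity) ?_
          have : ip (U j) z - ip (V j) z = ip (U j - V j) z := by
            simp only [ip, ← Finset.sum_sub_distrib, Pi.sub_apply, sub_mul]
          rw [this]
          exact (ip_le p hp _ _).trans (mul_le_mul_of_nonneg_right (hUV j) hQ)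
      _ ≤ _ := by
          rw [← Finset.sum_mul]
          exact mul_le_mul_of_nonneg_right hb (by positivity)
  rw [e]
  refine (abs_add_le _ _).trans ?_
  linarith

theorem prod_diff (x y x' y' B r : ℝ) (hx : |x| ≤ B) (hy' : |y'| ≤ B)
    (h1 : |x - x'| ≤ r * B) (h2 : |y - y'| ≤ r * B) : |x * y - x' * y'| ≤ 2 * r * B ^ 2 := by
  have hB : 0 ≤ B := (abs_nonneg _).trans hx
  have : x * y - x' * y' = x * (y - y') + (x - x') * y' := by ring
  rw [this]
  refine (abs_add_le _ _).trans ?_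
  rw [abs_mul, abs_mul]
  have := mul_le_mul hx h2 (abs_nonneg _) hB
  have := mul_le_mul h1 hy' (abs_nonneg _) ((abs_nonneg _).trans h1)
  nlinarith

theorem sInf_abs {D : Type*} (P : D → Prop) (hP : ∃ δ, P δ) (f : D → ℝ) (C : ℝ)
    (hf : ∀ δ, P δ → |f δ| ≤ C) : |sInf {t : ℝ | ∃ δ, P δ ∧ t = f δ}| ≤ C := by
  obtain ⟨δ, hδ⟩ := hP
  have hlb : ∀ t ∈ {t : ℝ | ∃ δ, P δ ∧ t = f δ}, -C ≤ t := by
    rintro t ⟨e, he, rfl⟩; exact (abs_le.1 (hf e he)).1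
  rw [abs_le]
  exact ⟨le_csInf ⟨_, δ, hδ, rfl⟩ hlb,
    (csInf_le ⟨-C, hlb⟩ ⟨δ, hδ, rfl⟩).trans (abs_le.1 (hf δ hδ)).2⟩

theorem sInf_sub_le {D : Type*} (P : D → Prop) (hP : ∃ δ, P δ) (f g : D → ℝ) (C c : ℝ)
    (hf : ∀ δ, P δ → |f δ| ≤ C) (hfg : ∀ δ, P δ → |f δ - g δ| ≤ c) :
    sInf {t : ℝ | ∃ δ, P δ ∧ t = f δ} - c ≤ sInf {t : ℝ | ∃ δ, P δ ∧ t = g δ} := by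
  obtain ⟨δ, hδ⟩ := hP
  have hlb : ∀ t ∈ {t : ℝ | ∃ δ, P δ ∧ t = f δ}, -C ≤ t := by
    rintro t ⟨e, he, rfl⟩; exact (abs_le.1 (hf e he)).1
  refine le_csInf ⟨_, δ, hδ, rfl⟩ ?_
  rintro t ⟨e, he, rfl⟩
  have h1 := csInf_le ⟨-C, hlb⟩ ⟨e, he, rfl⟩
  have h2 := (abs_le.1 (hfg e he)).2
  linarith

theorem sInf_diff {D : Type*} (P : D → Prop) (hP : ∃ δ, P δ) (f g : D → ℝ) (C c : ℝ)
    (hf : ∀ δ, P δ → |f δ| ≤ C) (hg : ∀ δ, P δ → |g δ| ≤ C) (hfg : ∀ δ, P δ → |f δ - g δ| ≤ c) :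
    |sInf {t : ℝ | ∃ δ, P δ ∧ t = f δ} - sInf {t : ℝ | ∃ δ, P δ ∧ t = g δ}| ≤ c := by
  have h1 := sInf_sub_le P hP f g C c hf hfg
  have h2 := sInf_sub_le P hP g f C c hg (fun δ h => by rw [abs_sub_comm]; exact hfg δ h)
  rw [abs_le]; constructor <;> linarith

theorem net_card (n m d c1 c2 : ℕ) (hn : 1 ≤ n) (h1 : (c1 : ℝ) ≤ (3 * n : ℝ) ^ m)
    (h2 : (c2 : ℝ) ≤ (3 * n : ℝ) ^ d) :
    ((c1 * (c1 * (c2 ^ m * c2 ^ m)) : ℕ) : ℝ) ≤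
      Real.exp (2 * (m : ℝ) * (1 + d) * Real.log (3 * n)) := by
  have hn' : (0 : ℝ) < 3 * n := by positivity
  have e : Real.exp (2 * (m : ℝ) * (1 + d) * Real.log (3 * n)) = (3 * n : ℝ) ^ (2 * m * (1 + d)) := by
    rw [← Real.rpow_natCast, Real.rpow_def_of_pos hn']
    push_cast
    ring_nf
  rw [e]
  push_cast
  have h3 : (c2 : ℝ) ^ m ≤ ((3 * n : ℝ) ^ d) ^ m := pow_le_pow_left₀ (by positivity) h2 m
  calc (c1 : ℝ) * (c1 * (c2 ^ m * c2 ^ m)) ≤ (3 * n : ℝ) ^ m * ((3 * n : ℝ) ^ m *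
      (((3 * n : ℝ) ^ d) ^ m * ((3 * n : ℝ) ^ d) ^ m)) := by gcongr
    _ = _ := by rw [← pow_mul, ← pow_add, ← pow_add, ← pow_add]; congr 1; ring

theorem stmt8 {d n m : ℕ} (hd : 1 ≤ d) (hn : 1 ≤ n) (hm : 1 ≤ m)
    (p A W ε : ℝ) (hp : 1 ≤ p) (hA : 0 < A) (hW : 0 < W) (hε : 0 ≤ ε)
    (x : Fin n → Fin d → ℝ) :
    Esign n (fun σ => sSup {r : ℝ |
        ∃ (a a' : Fin m → ℝ) (U U' : Fin m → Fin d → ℝ),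
        (∑ j, |a j|) ≤ A ∧ (∑ j, |a' j|) ≤ A ∧
        (∀ j, pNorm p (U j) ≤ W) ∧ (∀ j, pNorm p (U' j) ≤ W) ∧
        r = (1 / (n : ℝ)) * ∑ i, σ i *
          sInf {t : ℝ | ∃ δ : Fin d → ℝ, supNorm δ ≤ ε ∧
            t = reluNet a U (x i + δ) * reluNet a' U' (x i + δ)}}) ≤
      2 * A ^ 2 * W ^ 2 / (n : ℝ) *
        (Real.sqrt (∑ i,
            ((if p = 1 then supNorm (x i) else pNorm (p / (p - 1)) (x i)) ^ 2 +
              (d : ℝ) ^ (2 * (1 - 1 / p)) * ε ^ 2) ^ 2) *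
          Real.sqrt (4 * (m : ℝ) * (1 + (d : ℝ)) * Real.log (3 * (n : ℝ))) +
        4 * ((⨆ i, (if p = 1 then supNorm (x i) else pNorm (p / (p - 1)) (x i)) ^ 2) +
          (d : ℝ) ^ (2 * (1 - 1 / p)) * ε ^ 2)) := by
  classical
  have hn' : (1 : ℝ) ≤ n := by exact_mod_cast hn
  have hnpos : (0 : ℝ) < n := by linarith
  have hQ : ∀ v : Fin d → ℝ, (if p = 1 then supNorm v else pNorm (p / (p - 1)) v) = Qn p v :=
    fun v => rfl
  simp only [hQ]
  obtain ⟨B, hB⟩ : ∃ B : Fin n → ℝ, ∀ i, B i = Qn p (x i) ^ 2 + (d : ℝ) ^ (2 * (1 - 1 / p)) * ε ^ 2 :=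
    ⟨_, fun i => rfl⟩
  obtain ⟨Bm, hBm⟩ : ∃ Bm : ℝ, Bm = (⨆ i, Qn p (x i) ^ 2) + (d : ℝ) ^ (2 * (1 - 1 / p)) * ε ^ 2 :=
    ⟨_, rfl⟩
  have hBle : ∀ i, B i ≤ Bm := fun i => by
    rw [hB, hBm]
    exact add_le_add_left
      (le_ciSup (f := fun i => Qn p (x i) ^ 2) (Set.finite_range _).bddAbove i) _
  have hB0 : ∀ i, 0 ≤ B i := fun i => by rw [hB]; positivity
  rw [← hBm]
  simp only [← hB]
  have hP : ∃ δ : Fin d → ℝ, supNorm δ ≤ ε := ⟨0, by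
    have : Nonempty (Fin d) := ⟨⟨0, hd⟩⟩
    simpa [supNorm] using hε⟩
  obtain ⟨F, hF⟩ : ∃ F : (Fin m → ℝ) → (Fin m → ℝ) → (Fin m → Fin d → ℝ) → (Fin m → Fin d → ℝ) →
      Fin n → ℝ, ∀ a a' U U' i, F a a' U U' i = sInf {t : ℝ | ∃ δ : Fin d → ℝ, supNorm δ ≤ ε ∧
            t = reluNet a U (x i + δ) * reluNet a' U' (x i + δ)} := ⟨_, fun _ _ _ _ _ => rfl⟩
  simp only [← hF]
  have hprod : ∀ (a a' : Fin m → ℝ) (U U' : Fin m → Fin d → ℝ), (∑ j, |a j|) ≤ A →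
      (∑ j, |a' j|) ≤ A → (∀ j, pNorm p (U j) ≤ W) → (∀ j, pNorm p (U' j) ≤ W) → ∀ i,
      ∀ δ, supNorm δ ≤ ε → |reluNet a U (x i + δ) * reluNet a' U' (x i + δ)| ≤
        2 * A ^ 2 * W ^ 2 * B i := by
    intro a a' U U' ha ha' hU hU' i δ hδ
    have h1 := relu_abs p A W hp hW.le a U (x i + δ) ha hU
    have h2 := relu_abs p A W hp hW.le a' U' (x i + δ) ha' hU'
    have h3 := Qn_sq hd p hp (x i) δ ε hε hδ
    rw [← hB] at h3
    rw [abs_mul]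
    calc _ ≤ (A * W * Qn p (x i + δ)) * (A * W * Qn p (x i + δ)) :=
          mul_le_mul h1 h2 (abs_nonneg _) ((abs_nonneg _).trans h1)
      _ = A ^ 2 * W ^ 2 * Qn p (x i + δ) ^ 2 := by ring
      _ ≤ A ^ 2 * W ^ 2 * (2 * B i) := mul_le_mul_of_nonneg_left h3 (by positivity)
      _ = _ := by ring
  have hFabs : ∀ (a a' : Fin m → ℝ) (U U' : Fin m → Fin d → ℝ), (∑ j, |a j|) ≤ A →
      (∑ j, |a' j|) ≤ A → (∀ j, pNorm p (U j) ≤ W) → (∀ j, pNorm p (U' j) ≤ W) → ∀ i,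
      |F a a' U U' i| ≤ 2 * A ^ 2 * W ^ 2 * B i := by
    intro a a' U U' ha ha' hU hU' i
    rw [hF]
    exact sInf_abs _ hP _ _ (hprod a a' U U' ha ha' hU hU' i)
  have hFdiff : ∀ (a a' b b' : Fin m → ℝ) (U U' V V' : Fin m → Fin d → ℝ), (∑ j, |a j|) ≤ A →
      (∑ j, |a' j|) ≤ A → (∑ j, |b j|) ≤ A → (∑ j, |b' j|) ≤ A →
      (∀ j, pNorm p (U j) ≤ W) → (∀ j, pNorm p (U' j) ≤ W) →
      (∀ j, pNorm p (V j) ≤ W) → (∀ j, pNorm p (V' j) ≤ W) →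
      (∑ j, |a j - b j|) ≤ A * (1 / n) → (∑ j, |a' j - b' j|) ≤ A * (1 / n) →
      (∀ j, pNorm p (U j - V j) ≤ W * (1 / n)) → (∀ j, pNorm p (U' j - V' j) ≤ W * (1 / n)) → ∀ i,
      |F a a' U U' i - F b b' V V' i| ≤ 8 * A ^ 2 * W ^ 2 * B i * (1 / n) := by
    intro a a' b b' U U' V V' ha ha' hb hb' hU hU' hV hV' hab hab' hUV hUV' i
    rw [hF, hF]
    refine sInf_diff _ hP _ _ _ _ (hprod a a' U U' ha ha' hU hU' i)
      (hprod b b' V V' hb hb' hV hV' i) ?_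
    intro δ hδ
    have h3 := Qn_sq hd p hp (x i) δ ε hε hδ
    rw [← hB] at h3
    have h4 := prod_diff _ (reluNet a' U' (x i + δ)) (reluNet b V (x i + δ)) _ _ (2 * (1 / n))
      (relu_abs p A W hp hW.le a U (x i + δ) ha hU)
      (relu_abs p A W hp hW.le b' V' (x i + δ) hb' hV')
      (relu_diff p A W (1 / n) hp hW.le (by positivity) a b U V _ hab hb hU hUV)
      (relu_diff p A W (1 / n) hp hW.le (by positivity) a' b' U' V' _ hab' hb' hU' hUV')
    refine h4.trans ?_
    calc _ = (4 * A ^ 2 * W ^ 2 * (1 / n)) * Qn p (x i + δ) ^ 2 := by ring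
      _ ≤ (4 * A ^ 2 * W ^ 2 * (1 / n)) * (2 * B i) :=
          mul_le_mul_of_nonneg_left h3 (by positivity)
      _ = _ := by ring
  obtain ⟨Sa, a1, a2, a3⟩ := cover_p m 1 le_rfl n hn A hA
  obtain ⟨Su, u1, u2, u3⟩ := cover_p d p hp n hn W hW
  have p1 : ∀ v : Fin m → ℝ, pNorm 1 v = ∑ j, |v j| := fun v => by simp [pNorm]
  simp only [p1, Pi.sub_apply] at a1 a3
  have hSa : Nonempty Sa := by
    obtain ⟨c, hc, _⟩ := a3 0 (by simpa using hA.le)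
    exact ⟨⟨c, hc⟩⟩
  have hz : pNorm p (0 : Fin d → ℝ) ≤ W := by
    have : p ≠ 0 := by linarith
    simp [pNorm, Real.zero_rpow this, Real.zero_rpow (inv_ne_zero this), hW.le]
  have hSu : Nonempty Su := by
    obtain ⟨c, hc, _⟩ := u3 0 hz
    exact ⟨⟨c, hc⟩⟩
  let T := Sa × Sa × (Fin m → Su) × (Fin m → Su)
  let t : T → Fin n → ℝ := fun θ i => F θ.1.1 θ.2.1.1 (fun j => (θ.2.2.1 j).1) (fun j => (θ.2.2.2 j).1) i
  let M : (Fin n → Bool) → ℝ := fun s => Finset.univ.sup' Finset.univ_nonempty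
    (fun θ : T => ∑ i, (if s i then (1 : ℝ) else -1) * t θ i)
  have hlog : 0 < Real.log (3 * n) := Real.log_pos (by linarith)
  have hL : 0 < 2 * (m : ℝ) * (1 + d) * Real.log (3 * n) := by
    have : (0 : ℝ) < m := by exact_mod_cast hm
    positivity
  have hmass := massart n M t (fun i => 2 * A ^ 2 * W ^ 2 * B i) _ hL
    (by
      have := net_card n m d Sa.card Su.card hn a2 u2
      simpa [T] using this)
    (fun θ i => hFabs _ _ _ _ (a1 _ θ.1.2) (a1 _ θ.2.1.2) (fun j => u1 _ (θ.2.2.1 j).2)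
      (fun j => u1 _ (θ.2.2.2 j).2) i)
    (fun s => by
      obtain ⟨θ, _, h⟩ := Finset.exists_mem_eq_sup' (Finset.univ_nonempty (α := T))
        (fun θ : T => ∑ i, (if s i then (1 : ℝ) else -1) * t θ i)
      exact ⟨θ, h.le⟩)
  have hsup : ∀ s : Fin n → Bool, sSup {r : ℝ |
        ∃ (a a' : Fin m → ℝ) (U U' : Fin m → Fin d → ℝ),
        (∑ j, |a j|) ≤ A ∧ (∑ j, |a' j|) ≤ A ∧
        (∀ j, pNorm p (U j) ≤ W) ∧ (∀ j, pNorm p (U' j) ≤ W) ∧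
        r = (1 / (n : ℝ)) * ∑ i, (if s i then (1 : ℝ) else -1) * F a a' U U' i} ≤
        (1 / (n : ℝ)) * (M s + 8 * A ^ 2 * W ^ 2 * Bm) := by
    intro s
    refine csSup_le ⟨_, 0, 0, 0, 0, by simpa using hA.le, by simpa using hA.le,
      fun j => hz, fun j => hz, rfl⟩ ?_
    rintro r ⟨a, a', U, U', ha, ha', hU, hU', rfl⟩
    refine mul_le_mul_of_nonneg_left ?_ (by positivity)
    obtain ⟨b, hb, hab⟩ := a3 a ha
    obtain ⟨b', hb', hab'⟩ := a3 a' ha'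
    choose V hV hUV using fun j => u3 (U j) (hU j)
    choose V' hV' hUV' using fun j => u3 (U' j) (hU' j)
    simp only [div_eq_mul_one_div A (n : ℝ)] at hab hab'
    simp only [div_eq_mul_one_div W (n : ℝ)] at hUV hUV'
    have hM : ∑ i, (if s i then (1 : ℝ) else -1) * F b b' V V' i ≤ M s :=
      Finset.le_sup' (fun θ : T => ∑ i, (if s i then (1 : ℝ) else -1) * t θ i)
        (Finset.mem_univ ((⟨b, hb⟩, ⟨b', hb'⟩, (fun j => ⟨V j, hV j⟩), (fun j => ⟨V' j, hV' j⟩)) : T))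
    have hd1 : ∀ i, (if s i then (1 : ℝ) else -1) * F a a' U U' i ≤
        (if s i then (1 : ℝ) else -1) * F b b' V V' i + 8 * A ^ 2 * W ^ 2 * Bm * (1 / n) := by
      intro i
      have h1 := hFdiff a a' b b' U U' V V' ha ha' (a1 b hb) (a1 b' hb') hU hU'
        (fun j => u1 _ (hV j)) (fun j => u1 _ (hV' j)) hab hab' hUV hUV' i
      have h2 : 8 * A ^ 2 * W ^ 2 * B i * (1 / n) ≤ 8 * A ^ 2 * W ^ 2 * Bm * (1 / n) := by
        have := hBle i
        gcongr
      have h3 := abs_le.1 (h1.trans h2)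
      split_ifs <;> linarith [h3.1, h3.2]
    have h5 := Finset.sum_le_sum fun i (_ : i ∈ Finset.univ) => hd1 i
    rw [Finset.sum_add_distrib] at h5
    simp only [Finset.sum_const, Finset.card_univ, Fintype.card_fin, nsmul_eq_mul] at h5
    have h6 : (n : ℝ) * (8 * A ^ 2 * W ^ 2 * Bm * (1 / n)) = 8 * A ^ 2 * W ^ 2 * Bm := by
      field_simp
    linarith
  have hE : (∑ s, M s) / 2 ^ n ≤ 2 * A ^ 2 * W ^ 2 * (Real.sqrt (∑ i, B i ^ 2) *
      Real.sqrt (4 * (m : ℝ) * (1 + (d : ℝ)) * Real.log (3 * (n : ℝ)))) := by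
    refine hmass.trans (le_of_eq ?_)
    have e1 : ∑ i, (2 * A ^ 2 * W ^ 2 * B i) ^ 2 = (2 * A ^ 2 * W ^ 2) ^ 2 * ∑ i, B i ^ 2 := by
      rw [Finset.mul_sum]
      exact Finset.sum_congr rfl fun i _ => by ring
    rw [e1, Real.sqrt_mul (by positivity), Real.sqrt_sq (by positivity), mul_assoc]
    congr 3
    ring
  unfold Esign
  calc _ ≤ (∑ s : Fin n → Bool, (1 / (n : ℝ)) * (M s + 8 * A ^ 2 * W ^ 2 * Bm)) / 2 ^ n := by
        refine div_le_div_of_nonneg_right (Finset.sum_le_sum fun s _ => hsup s) (by positivity)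
    _ = (1 / (n : ℝ)) * ((∑ s, M s) / 2 ^ n + 8 * A ^ 2 * W ^ 2 * Bm) := by
        rw [← Finset.mul_sum, Finset.sum_add_distrib]
        simp only [Finset.sum_const, Finset.card_univ, Fintype.card_pi, Fintype.card_bool,
          Finset.prod_const, Fintype.card_fin, nsmul_eq_mul]
        push_cast
        field_simp
    _ ≤ (1 / (n : ℝ)) * (2 * A ^ 2 * W ^ 2 * (Real.sqrt (∑ i, B i ^ 2) *
      Real.sqrt (4 * (m : ℝ) * (1 + (d : ℝ)) * Real.log (3 * (n : ℝ)))) + 8 * A ^ 2 * W ^ 2 * Bm) :=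
        mul_le_mul_of_nonneg_left (by linarith) (by positivity)
    _ = _ := by ring
end

section
/- For linear regression with the squared loss, the empirical adversarial HΔH discrepancy is controlled by its standard counterpart: disc^{adv}(Ŝ, T̂) ≤ disc(Ŝ, T̂) + 8 √d ε W² · ( (1/n_T) Σ_{x ∈ T̂} ‖x‖_2 + (1/n_S) Σ_{x ∈ Ŝ} ‖x‖_2 ) · κ, where κ = 1 if 1 ≤ p ≤ 2 and κ = d^{1−2/p} if p > 2. -/
open scoped BigOperators

lemma abs_le_of_supNorm {d : ℕ} {v : Fin d → ℝ} {e : ℝ} (h : supNorm v ≤ e) (i : Fin d) :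
    |v i| ≤ e :=
  le_trans (le_ciSup (f := fun i => |v i|) (Set.finite_range _).bddAbove i) h

lemma ip_sub_add {d : ℕ} (w w' x δ : Fin d → ℝ) :
    ip w (x + δ) - ip w' (x + δ) = ip (w - w') x + ip (w - w') δ := by
  simp only [ip, Pi.add_apply, Pi.sub_apply, ← Finset.sum_sub_distrib, ← Finset.sum_add_distrib]
  exact Finset.sum_congr rfl fun i _ => by ring

lemma ip_sub' {d : ℕ} (w w' x : Fin d → ℝ) :
    ip w x - ip w' x = ip (w - w') x := by
  simp only [ip, Pi.sub_apply, ← Finset.sum_sub_distrib]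
  exact Finset.sum_congr rfl fun i _ => by ring

lemma adv_eq {d : ℕ} (w w' x : Fin d → ℝ) (e : ℝ) (he : 0 ≤ e) :
    sSup {t : ℝ | ∃ δ : Fin d → ℝ, supNorm δ ≤ e ∧
      t = (ip w (x + δ) - ip w' (x + δ)) ^ 2} =
    (|ip (w - w') x| + e * ∑ i, |(w - w') i|) ^ 2 := by
  apply IsGreatest.csSup_eq
  simp only [ip_sub_add]
  generalize w - w' = u
  have key : ∀ s : ℝ, |s| ≤ 1 → ∃ δ : Fin d → ℝ, supNorm δ ≤ e ∧ 
      ip u δ = s * (e * ∑ i, |u i|) := by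
    intro s hs
    refine ⟨fun i => s * e * SignType.sign (u i), ?_, ?_⟩
    · apply Real.iSup_le _ he
      intro i
      have h1 : |((SignType.sign (u i) : SignType) : ℝ)| ≤ 1 := by
        rcases lt_trichotomy (u i) 0 with h | h | h <;> simp [h]
      rw [abs_mul, abs_mul, abs_of_nonneg he]
      have := abs_nonneg s
      have := abs_nonneg ((SignType.sign (u i) : SignType) : ℝ)
      calc |s| * e * _ ≤ 1 * e * 1 := by gcongr
        _ = e := by ring
    · simp only [ip, Finset.mul_sum]
      refine Finset.sum_congr rfl fun i _ => ?_
      rw [← self_mul_sign (u i)]; ring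
  constructor
  · rcases le_total 0 (ip u x) with h | h
    · obtain ⟨δ, h1, h2⟩ := key 1 (by simp)
      exact ⟨δ, h1, by rw [h2, abs_of_nonneg h]; ring⟩
    · obtain ⟨δ, h1, h2⟩ := key (-1) (by simp)
      exact ⟨δ, h1, by rw [h2, abs_of_nonpos h]; ring⟩
  · rintro t ⟨δ, h1, rfl⟩
    have h2 : |ip u δ| ≤ e * ∑ i, |u i| := by
      unfold ip
      refine (Finset.abs_sum_le_sum_abs _ _).trans ?_
      rw [Finset.mul_sum]
      refine Finset.sum_le_sum fun i _ => ?_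
      rw [abs_mul, mul_comm]
      exact mul_le_mul_of_nonneg_right (abs_le_of_supNorm h1 i) (abs_nonneg _)
    rw [← sq_abs]
    exact pow_le_pow_left₀ (abs_nonneg _) ((abs_add_le _ _).trans (by linarith)) 2

noncomputable def kap (d : ℕ) (p : ℝ) : ℝ := if p ≤ 2 then 1 else (d : ℝ) ^ (1 - 2 / p)

lemma sum_sq_le {d : ℕ} (p W : ℝ) (hp : 1 ≤ p) (hW : 0 < W) (w : Fin d → ℝ)
    (h : pNorm p w ≤ W) : ∑ i, (w i) ^ 2 ≤ kap d p * W ^ 2 := by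
  have hp0 : 0 < p := by linarith
  have hs0 : 0 ≤ ∑ i, |w i| ^ p := Finset.sum_nonneg fun i _ => by positivity
  have hs : ∑ i, |w i| ^ p ≤ W ^ p := by
    have := Real.rpow_le_rpow (Real.rpow_nonneg hs0 _) h hp0.le
    rwa [← Real.rpow_mul hs0, one_div_mul_cancel hp0.ne', Real.rpow_one] at this
  unfold kap
  split_ifs with h2
  · have hi : ∀ i, |w i| ≤ W := by
      intro i
      have := (Finset.single_le_sum (f := fun i => |w i| ^ p) (fun i _ => by positivity)
        (Finset.mem_univ i)).trans hs
      exact (Real.rpow_le_rpow_iff (abs_nonneg _) hW.le hp0).1 this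
    have hi2 : ∀ i, (w i) ^ 2 ≤ |w i| ^ p * W ^ (2 - p) := by
      intro i
      have : (w i) ^ 2 = |w i| ^ p * |w i| ^ (2 - p) := by
        rw [← Real.rpow_add' (abs_nonneg _) (by norm_num)]
        simp
      rw [this]
      have : 0 ≤ 2 - p := by linarith
      gcongr
      exact hi i
    calc _ ≤ ∑ i, |w i| ^ p * W ^ (2 - p) := Finset.sum_le_sum fun i _ => hi2 i
      _ = (∑ i, |w i| ^ p) * W ^ (2 - p) := by rw [Finset.sum_mul]
      _ ≤ W ^ p * W ^ (2 - p) := by gcongr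
      _ = _ := by rw [← Real.rpow_add hW]; simp
  · push Not at h2
    have h3 := Real.rpow_sum_le_const_mul_sum_rpow (Finset.univ) (fun i => (w i) ^ 2)
      (p := p / 2) (by linarith)
    have e1 : ∀ i, |(w i) ^ 2| ^ (p / 2) = |w i| ^ p := by
      intro i
      rw [abs_pow, ← Real.rpow_natCast, ← Real.rpow_mul (abs_nonneg _)]
      congr 1; push_cast; ring
    simp only [e1, Finset.card_univ, Fintype.card_fin] at h3
    simp only [abs_pow, sq_abs] at h3
    have hq0 : 0 ≤ ∑ i, (w i) ^ 2 := Finset.sum_nonneg fun i _ => by positivity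
    have h4 : (∑ i, (w i) ^ 2) ^ (p / 2) ≤ (d : ℝ) ^ (p / 2 - 1) * W ^ p :=
      h3.trans (by gcongr)
    have h5 := Real.rpow_le_rpow (by positivity) h4 (show 0 ≤ 2 / p by positivity)
    rw [← Real.rpow_mul hq0, Real.mul_rpow (by positivity) (by positivity),
      ← Real.rpow_mul (by positivity), ← Real.rpow_mul hW.le] at h5
    have a1 : p / 2 * (2 / p) = 1 := by field_simp
    have a2 : (p / 2 - 1) * (2 / p) = 1 - 2 / p := by field_simp
    have a3 : p * (2 / p) = (2 : ℕ) := by push_cast; field_simp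
    rwa [a1, a2, a3, Real.rpow_one, Real.rpow_natCast] at h5

lemma kap_nonneg (d : ℕ) (p : ℝ) : 0 ≤ kap d p := by
  unfold kap; split_ifs <;> positivity

lemma twoNorm_sub {d : ℕ} (p W : ℝ) (hp : 1 ≤ p) (hW : 0 < W) (w w' : Fin d → ℝ)
    (h : pNorm p w ≤ W) (h' : pNorm p w' ≤ W) : (twoNorm (w - w')) ^ 2 ≤ 4 * W ^ 2 * kap d p := by
  have h1 := sum_sq_le p W hp hW w h
  have h2 := sum_sq_le p W hp hW w' h'
  unfold twoNorm
  rw [Real.sq_sqrt (Finset.sum_nonneg fun i _ => by positivity)]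
  calc ∑ i, ((w - w') i) ^ 2 ≤ ∑ i, (2 * (w i) ^ 2 + 2 * (w' i) ^ 2) := by
        refine Finset.sum_le_sum fun i _ => ?_
        simp only [Pi.sub_apply]
        nlinarith [sq_nonneg (w i + w' i)]
    _ = 2 * ∑ i, (w i) ^ 2 + 2 * ∑ i, (w' i) ^ 2 := by
        rw [Finset.sum_add_distrib, Finset.mul_sum, Finset.mul_sum]
    _ ≤ _ := by linarith

lemma abs_ip_le {d : ℕ} (u x : Fin d → ℝ) : |ip u x| ≤ twoNorm u * twoNorm x := by
  unfold twoNorm ip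
  rw [← Real.sqrt_mul (Finset.sum_nonneg fun i _ => by positivity)]
  exact Real.abs_le_sqrt (Finset.sum_mul_sq_le_sq_mul_sq _ _ _)

lemma l1_le {d : ℕ} (u : Fin d → ℝ) : ∑ i, |u i| ≤ Real.sqrt d * twoNorm u := by
  unfold twoNorm
  rw [← Real.sqrt_mul (by positivity)]
  apply Real.le_sqrt_of_sq_le
  have := sq_sum_le_card_mul_sum_sq (s := Finset.univ) (f := fun i => |u i|)
  simpa using this

lemma pNorm_zero' {d : ℕ} (p W : ℝ) (hp : 1 ≤ p) (hW : 0 < W) :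
    pNorm p (0 : Fin d → ℝ) ≤ W := by
  have hp0 : p ≠ 0 := by linarith
  simp [pNorm, Real.zero_rpow hp0, Real.zero_rpow (inv_ne_zero hp0), hW.le]

lemma avg_eq {n d : ℕ} (hn : 1 ≤ n) (a : Fin n → ℝ) (c : ℝ) :
    (1 / (n : ℝ)) * ∑ i, (|a i| + c) ^ 2 =
      (1 / (n : ℝ)) * ∑ i, (a i) ^ 2 + 2 * c * ((1 / (n : ℝ)) * ∑ i, |a i|) + c ^ 2 := by
  have hn' : (n : ℝ) ≠ 0 := by positivity
  have : ∀ i, (|a i| + c) ^ 2 = (a i) ^ 2 + 2 * c * |a i| + c ^ 2 := by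
    intro i; rw [← sq_abs (a i)]; ring
  simp only [this, Finset.sum_add_distrib, ← Finset.mul_sum, Finset.sum_const, Finset.card_univ,
    Fintype.card_fin, nsmul_eq_mul]
  field_simp

lemma avg_ip_le {n d : ℕ} (u : Fin d → ℝ) (x : Fin n → Fin d → ℝ) :
    (1 / (n : ℝ)) * ∑ i, |ip u (x i)| ≤ twoNorm u * ((1 / (n : ℝ)) * ∑ i, twoNorm (x i)) := by
  rw [mul_left_comm, Finset.mul_sum Finset.univ _ (twoNorm u)]
  gcongr with i
  exact abs_ip_le _ _

lemma avg_sq_le {n d : ℕ} (u : Fin d → ℝ) (x : Fin n → Fin d → ℝ) :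
    (1 / (n : ℝ)) * ∑ i, (ip u (x i)) ^ 2 ≤
      (twoNorm u) ^ 2 * ((1 / (n : ℝ)) * ∑ i, (twoNorm (x i)) ^ 2) := by
  rw [mul_left_comm, Finset.mul_sum Finset.univ _ ((twoNorm u) ^ 2)]
  gcongr with i
  rw [← sq_abs, ← mul_pow]
  exact pow_le_pow_left₀ (abs_nonneg _) (abs_ip_le _ _) 2

theorem stmt11 {d nS nT : ℕ} (hd : 1 ≤ d) (hnS : 1 ≤ nS) (hnT : 1 ≤ nT)
    (p W ε : ℝ) (hp : 1 ≤ p) (hW : 0 < W) (hε : 0 ≤ ε)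
    (xS : Fin nS → Fin d → ℝ) (xT : Fin nT → Fin d → ℝ) :
    sSup {r : ℝ | ∃ w w' : Fin d → ℝ, pNorm p w ≤ W ∧ pNorm p w' ≤ W ∧
        r = |(1 / (nT : ℝ)) * (∑ i, sSup {t : ℝ | ∃ δ : Fin d → ℝ, supNorm δ ≤ ε ∧
                t = (ip w (xT i + δ) - ip w' (xT i + δ)) ^ 2}) -
             (1 / (nS : ℝ)) * ∑ i, sSup {t : ℝ | ∃ δ : Fin d → ℝ, supNorm δ ≤ ε ∧
                t = (ip w (xS i + δ) - ip w' (xS i + δ)) ^ 2}|} ≤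
      sSup {r : ℝ | ∃ w w' : Fin d → ℝ, pNorm p w ≤ W ∧ pNorm p w' ≤ W ∧
        r = |(1 / (nT : ℝ)) * (∑ i, (ip w (xT i) - ip w' (xT i)) ^ 2) -
             (1 / (nS : ℝ)) * ∑ i, (ip w (xS i) - ip w' (xS i)) ^ 2|} +
      8 * Real.sqrt (d : ℝ) * ε * W ^ 2 *
        ((1 / (nT : ℝ)) * (∑ i, twoNorm (xT i)) +
          (1 / (nS : ℝ)) * ∑ i, twoNorm (xS i)) *
        (if p ≤ 2 then 1 else (d : ℝ) ^ (1 - 2 / p)) := by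
  change _ ≤ _ + _ * kap d p
  simp only [adv_eq _ _ _ ε hε]
  simp only [ip_sub']
  have hk := kap_nonneg d p
  have tn : ∀ v : Fin d → ℝ, 0 ≤ twoNorm v := fun v => Real.sqrt_nonneg _
  apply csSup_le
  · exact ⟨_, 0, 0, pNorm_zero' p W hp hW, pNorm_zero' p W hp hW, rfl⟩
  rintro r ⟨w, w', h, h', rfl⟩
  have hle : |(1 / (nT : ℝ)) * (∑ i, (ip (w - w') (xT i)) ^ 2) -
             (1 / (nS : ℝ)) * ∑ i, (ip (w - w') (xS i)) ^ 2| ≤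
      sSup {r : ℝ | ∃ w w' : Fin d → ℝ, pNorm p w ≤ W ∧ pNorm p w' ≤ W ∧
        r = |(1 / (nT : ℝ)) * (∑ i, (ip (w - w') (xT i)) ^ 2) -
             (1 / (nS : ℝ)) * ∑ i, (ip (w - w') (xS i)) ^ 2|} := by
    apply le_csSup
    · refine ⟨4 * W ^ 2 * kap d p * ((1 / (nT : ℝ)) * ∑ i, (twoNorm (xT i)) ^ 2) +
        4 * W ^ 2 * kap d p * ((1 / (nS : ℝ)) * ∑ i, (twoNorm (xS i)) ^ 2), ?_⟩
      rintro r ⟨v, v', hv, hv', rfl⟩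
      have hu := twoNorm_sub p W hp hW v v' hv hv'
      have a1 := (avg_sq_le (v - v') xT).trans (mul_le_mul_of_nonneg_right hu (by positivity))
      have a2 := (avg_sq_le (v - v') xS).trans (mul_le_mul_of_nonneg_right hu (by positivity))
      have b1 : 0 ≤ (1 / (nT : ℝ)) * ∑ i, (ip (v - v') (xT i)) ^ 2 := by positivity
      have b2 : 0 ≤ (1 / (nS : ℝ)) * ∑ i, (ip (v - v') (xS i)) ^ 2 := by positivity
      rw [abs_le]; constructor <;> linarith
    · exact ⟨w, w', h, h', rfl⟩
  refine le_trans ?_ (add_le_add_left hle _)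
  have hu := twoNorm_sub p W hp hW w w' h h'
  rw [avg_eq (d := d) hnT, avg_eq (d := d) hnS]
  generalize w - w' = u at *
  have a1 := avg_ip_le u xT
  have a2 := avg_ip_le u xS
  have b1 : 0 ≤ (1 / (nT : ℝ)) * ∑ i, |ip u (xT i)| := by positivity
  have b2 : 0 ≤ (1 / (nS : ℝ)) * ∑ i, |ip u (xS i)| := by positivity
  have c1 : 0 ≤ (1 / (nT : ℝ)) * ∑ i, twoNorm (xT i) :=
    mul_nonneg (by positivity) (Finset.sum_nonneg fun i _ => tn _)
  have c2 : 0 ≤ (1 / (nS : ℝ)) * ∑ i, twoNorm (xS i) :=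
    mul_nonneg (by positivity) (Finset.sum_nonneg fun i _ => tn _)
  have l1 := l1_le u
  have l0 : 0 ≤ ∑ i, |u i| := by positivity
  have t0 := tn u
  generalize (1 / (nT : ℝ)) * ∑ i, |ip u (xT i)| = A at *
  generalize (1 / (nS : ℝ)) * ∑ i, |ip u (xS i)| = B at *
  generalize (1 / (nT : ℝ)) * ∑ i, twoNorm (xT i) = C at *
  generalize (1 / (nS : ℝ)) * ∑ i, twoNorm (xS i) = D at *
  generalize (1 / (nT : ℝ)) * ∑ i, (ip u (xT i)) ^ 2 = P at *
  generalize (1 / (nS : ℝ)) * ∑ i, (ip u (xS i)) ^ 2 = Q at *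
  generalize (∑ i, |u i|) = L at *
  have e : P + 2 * (ε * L) * A + (ε * L) ^ 2 - (Q + 2 * (ε * L) * B + (ε * L) ^ 2) =
    (P - Q) + 2 * ε * L * (A - B) := by ring
  rw [e]
  refine (abs_add_le _ _).trans (add_le_add_right ?_ _)
  rw [abs_mul, abs_of_nonneg (by positivity : 0 ≤ 2 * ε * L)]
  have f : |A - B| ≤ twoNorm u * (C + D) := by
    rw [abs_le]; constructor <;> nlinarith
  calc 2 * ε * L * |A - B| ≤ 2 * ε * (Real.sqrt d * twoNorm u) * (twoNorm u * (C + D)) := by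
        gcongr
    _ = 2 * ε * Real.sqrt d * (C + D) * (twoNorm u) ^ 2 := by ring
    _ ≤ 2 * ε * Real.sqrt d * (C + D) * (4 * W ^ 2 * kap d p) := by gcongr
    _ = _ := by ring
end
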